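/- Let n ≥ 3, M ∈ ℕ, and let α₁, …, αₙ be Hermitian M×M matrices satisfying the anticommutation relations α_j α_l + α_l α_j = 2δ_{jl} I_M. Let e ∈ ℝⁿ be a unit vector, κ ≥ 0, and let y ∈ ℝⁿ be a vector with y_⊥ := y − (y,e)e ≠ 0. Set ẽ = y_⊥/|y_⊥|, G^± = ((y,e)² + (κ ± |y_⊥|)²)^{1/2}, D = Σ_{j=1}^n (y_j + iκ e_j) α_j, and P^±_ẽ = (1/2)(I_M ∓ i (Σ_{j=1}^n e_j α_j)(Σ_{j=1}^n ẽ_j α_j)). Then: (i) P^+_ẽ and P^−_ẽ are orthogonal projections on ℂ^M with P^+_ẽ + P^−_ẽ = I_M; (ii) P^±_ẽ D P^±_ẽ = 0 (the zero M×M matrix); (iii) for every u ∈ ℂ^M, ‖D P^±_ẽ u‖_{ℂ^M} = G^± ‖P^±_ẽ u‖_{ℂ^M}. -/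

import Mathlib

open Complex
open scoped BigOperators RealInnerProductSpace

noncomputable section

namespace Danilov

abbrev E (n : ℕ) := EuclideanSpace ℝ (Fin n)

/-- Perpendicular component `y_⊥ = y − (y,e)e`. -/
def perp {n : ℕ} (e y : E n) : E n := y - (⟪y, e⟫ : ℝ) • e

/-- The Clifford product relation for real linear combinations of the generators. -/
theorem sum_smul_mul_add_swap {n M : ℕ} (α : Fin n → Matrix (Fin M) (Fin M) ℂ)
    (hanti : ∀ j l, α j * α l + α l * α j =
      if j = l then (2 : ℂ) • (1 : Matrix (Fin M) (Fin M) ℂ) else 0) (a b : E n) :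
    (∑ j, (a j : ℂ) • α j) * (∑ j, (b j : ℂ) • α j) +
      (∑ j, (b j : ℂ) • α j) * (∑ j, (a j : ℂ) • α j) =
      ((2 * ⟪a, b⟫ : ℝ) : ℂ) • (1 : Matrix (Fin M) (Fin M) ℂ) := by
  have h : ∀ j l, ((a j : ℂ) • α j) * ((b l : ℂ) • α l) + ((b l : ℂ) • α l) * ((a j : ℂ) • α j)
      = if j = l then (2 * (a j : ℂ) * (b j : ℂ)) • (1 : Matrix (Fin M) (Fin M) ℂ) else 0 := by
    intro j l
    have h1 : ((a j : ℂ) • α j) * ((b l : ℂ) • α l) + ((b l : ℂ) • α l) * ((a j : ℂ) • α j)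
        = ((a j : ℂ) * (b l : ℂ)) • (α j * α l + α l * α j) := by
      simp only [smul_mul_smul_comm, smul_add]
      rw [mul_comm (b l : ℂ)]
    rw [h1, hanti]
    split_ifs with hjl
    · subst hjl
      rw [smul_smul]
      congr 1
      ring
    · simp
  rw [Finset.sum_mul_sum, Finset.sum_mul_sum, Finset.sum_comm (s := Finset.univ)
    (f := fun i j => ((b i : ℂ) • α i) * ((a j : ℂ) • α j)), ← Finset.sum_add_distrib]
  simp only [← Finset.sum_add_distrib, h, Finset.sum_ite_eq, Finset.mem_univ, if_true]
  rw [← Finset.sum_smul]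
  congr 1
  simp only [PiLp.inner_apply, RCLike.inner_apply, conj_trivial, Finset.mul_sum]
  push_cast
  exact Finset.sum_congr rfl fun j _ => by ring

theorem isHermitian_sum_smul {n M : ℕ} (α : Fin n → Matrix (Fin M) (Fin M) ℂ)
    (hherm : ∀ j, (α j).IsHermitian) (a : E n) : (∑ j, (a j : ℂ) • α j).IsHermitian := by
  simp only [Matrix.IsHermitian, Matrix.conjTranspose_sum, Matrix.conjTranspose_smul,
    (hherm _).eq, RCLike.star_def, Complex.conj_ofReal]

theorem norm_sq_toLp {M : ℕ} (v : Fin M → ℂ) :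
    ((‖(WithLp.equiv 2 (Fin M → ℂ)).symm v‖ ^ 2 : ℝ) : ℂ) = star v ⬝ᵥ v := by
  rw [EuclideanSpace.norm_sq_eq]
  simp only [dotProduct, Pi.star_apply, RCLike.star_def, Complex.conj_mul']
  push_cast
  rfl

/-- If `DᴴD` acts on `v` as multiplication by `c`, then `D` scales the norm of `v` by `√c`. -/
theorem norm_mulVec_eq_sqrt_mul {M : ℕ} (D : Matrix (Fin M) (Fin M) ℂ) (v : Fin M → ℂ) (c : ℝ)
    (hc : 0 ≤ c) (h : (D.conjTranspose * D).mulVec v = (c : ℂ) • v) :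
    ‖(WithLp.equiv 2 (Fin M → ℂ)).symm (D.mulVec v)‖ =
      Real.sqrt c * ‖(WithLp.equiv 2 (Fin M → ℂ)).symm v‖ := by
  have h1 : ((‖(WithLp.equiv 2 (Fin M → ℂ)).symm (D.mulVec v)‖ ^ 2 : ℝ) : ℂ) =
      ((c * ‖(WithLp.equiv 2 (Fin M → ℂ)).symm v‖ ^ 2 : ℝ) : ℂ) := by
    rw [Complex.ofReal_mul, norm_sq_toLp, norm_sq_toLp, Matrix.star_mulVec,
      ← Matrix.dotProduct_mulVec, Matrix.mulVec_mulVec, h, dotProduct_smul, smul_eq_mul]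
  have h2 := Complex.ofReal_injective h1
  rw [← Real.sqrt_sq (norm_nonneg ((WithLp.equiv 2 (Fin M → ℂ)).symm (D.mulVec v))), h2,
    Real.sqrt_mul hc, Real.sqrt_sq (norm_nonneg _)]

/-- Two anticommuting Hermitian involutions `A`, `B` give a projection `½(1 - iAB)`, which is
off-diagonal for `D = (t + iκ)A + sB`, and on whose range `D` scales norms by
`√(t² + (κ + s)²)`. -/
theorem projection_of_anticommute {M : ℕ} (A B : Matrix (Fin M) (Fin M) ℂ)
    (hA : A.IsHermitian) (hB : B.IsHermitian) (hAA : A * A = 1) (hBB : B * B = 1)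
    (hBA : B * A = -(A * B)) (t s κ : ℝ) (D P : Matrix (Fin M) (Fin M) ℂ)
    (hD : D = ((t : ℂ) + Complex.I * κ) • A + (s : ℂ) • B)
    (hP : P = (1 / 2 : ℂ) • ((1 : Matrix (Fin M) (Fin M) ℂ) - Complex.I • (A * B))) :
    P.IsHermitian ∧ P * P = P ∧ P * D * P = 0 ∧
    ∀ u : Fin M → ℂ,
      ‖(WithLp.equiv 2 (Fin M → ℂ)).symm (D.mulVec (P.mulVec u))‖ =
        Real.sqrt (t ^ 2 + (κ + s) ^ 2) *
          ‖(WithLp.equiv 2 (Fin M → ℂ)).symm (P.mulVec u)‖ := by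
  obtain ⟨J, hJ⟩ : ∃ J, J = Complex.I • (A * B) := ⟨_, rfl⟩
  rw [← hJ] at hP
  have hJH : J.conjTranspose = J := by
    rw [hJ, Matrix.conjTranspose_smul, Matrix.conjTranspose_mul, hA.eq, hB.eq, hBA]
    simp
  have hAJ : A * J = Complex.I • B := by
    rw [hJ, mul_smul_comm, ← mul_assoc, hAA, one_mul]
  have hJA : J * A = -(Complex.I • B) := by
    rw [hJ, smul_mul_assoc, mul_assoc, hBA, mul_neg, ← mul_assoc, hAA, one_mul, smul_neg]
  have hJB : J * B = Complex.I • A := by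
    rw [hJ, smul_mul_assoc, mul_assoc, hBB, mul_one]
  have hBJ : B * J = -(Complex.I • A) := by
    rw [hJ, mul_smul_comm, ← mul_assoc, hBA, neg_mul, mul_assoc, hBB, mul_one, smul_neg]
  have hJJ : J * J = 1 := by
    nth_rewrite 2 [hJ]
    rw [mul_smul_comm, ← mul_assoc, hJA, neg_mul, smul_mul_assoc, hBB, smul_neg, smul_smul,
      Complex.I_mul_I, neg_smul, one_smul, neg_neg]
  have hDJ : D * J = -(J * D) := by
    rw [hD, add_mul, mul_add, smul_mul_assoc, smul_mul_assoc, mul_smul_comm, mul_smul_comm,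
      hAJ, hJA, hJB, hBJ]
    simp only [smul_neg]
    abel
  have hPP : P * P = P := by
    rw [hP, smul_mul_smul_comm, mul_sub, sub_mul, sub_mul, hJJ, one_mul, mul_one, one_mul]
    module
  have hJP : J * P = -P := by
    rw [hP, mul_smul_comm, mul_sub, hJJ, mul_one]
    module
  refine ⟨?_, hPP, ?_, fun u => ?_⟩
  · rw [Matrix.IsHermitian, hP, Matrix.conjTranspose_smul, Matrix.conjTranspose_sub, hJH]
    simp
  · have hDP : P * D = (1 / 2 : ℂ) • (D + D * J) := by
      rw [hDJ, hP, smul_mul_assoc, sub_mul, one_mul, sub_eq_add_neg]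
    rw [hDP, smul_mul_assoc, add_mul, mul_assoc, hJP, mul_neg, add_neg_cancel, smul_zero]
  · apply norm_mulVec_eq_sqrt_mul _ _ _ (by positivity)
    have hAB : A * B = -(Complex.I • J) := by
      rw [hJ, smul_smul, Complex.I_mul_I, neg_smul, one_smul, neg_neg]
    have hDD : D.conjTranspose * D =
        ((t : ℂ) ^ 2 + κ ^ 2 + s ^ 2) • (1 : Matrix (Fin M) (Fin M) ℂ) -
          (2 * (κ : ℂ) * s) • J := by
      have hDH : D.conjTranspose = ((t : ℂ) - Complex.I * κ) • A + (s : ℂ) • B := by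
        rw [hD, Matrix.conjTranspose_add, Matrix.conjTranspose_smul, Matrix.conjTranspose_smul,
          hA.eq, hB.eq]
        simp [sub_eq_add_neg]
      rw [hDH, hD, add_mul, mul_add, mul_add]
      simp only [smul_mul_smul_comm, hAA, hBB, hBA, hAB, neg_neg]
      match_scalars
      · linear_combination (-(κ : ℂ) ^ 2) * Complex.I_sq
      · linear_combination (2 * (κ : ℂ) * s) * Complex.I_sq
    rw [Matrix.mulVec_mulVec, hDD, sub_mul, smul_mul_assoc, smul_mul_assoc, hJP, one_mul,
      ← Matrix.smul_mulVec]
    congr 1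
    push_cast
    module

/-- **Algebraic identities (3.13), (3.14).** Given Hermitian matrices `α_j` with
`α_jα_l + α_lα_j = 2δ_{jl}I`, a unit vector `e`, `κ ≥ 0`, and `y` with `y_⊥ ≠ 0`,
setting `ẽ = y_⊥/|y_⊥|`, `G^± = ((y,e)² + (κ ± |y_⊥|)²)^{1/2}`,
`D = ∑_j (y_j + iκe_j) α_j` and `P^±_ẽ = ½(I ∓ i(∑ e_jα_j)(∑ ẽ_jα_j))`, one has:
`P^±` are orthogonal projections summing to `I`; `P^± D P^± = 0`; and
`‖D P^± u‖ = G^± ‖P^± u‖` for all `u ∈ ℂ^M`. -/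
theorem statement_18 (n M : ℕ) (hn : 3 ≤ n)
    (α : Fin n → Matrix (Fin M) (Fin M) ℂ)
    (hherm : ∀ j, (α j).IsHermitian)
    (hanti : ∀ j l, α j * α l + α l * α j =
      if j = l then (2 : ℂ) • (1 : Matrix (Fin M) (Fin M) ℂ) else 0)
    (e : E n) (heu : ‖e‖ = 1) (κ : ℝ) (hκ : 0 ≤ κ)
    (y : E n) (hy : perp e y ≠ 0)
    (etil : E n) (hetil : etil = ‖perp e y‖⁻¹ • perp e y)
    (Gp Gm : ℝ)
    (hGp : Gp = Real.sqrt (⟪y, e⟫ ^ 2 + (κ + ‖perp e y‖) ^ 2))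
    (hGm : Gm = Real.sqrt (⟪y, e⟫ ^ 2 + (κ - ‖perp e y‖) ^ 2))
    (D : Matrix (Fin M) (Fin M) ℂ)
    (hD : D = ∑ j : Fin n, ((y j : ℂ) + Complex.I * κ * (e j : ℂ)) • α j)
    (Pp Pm : Matrix (Fin M) (Fin M) ℂ)
    (hPp : Pp = (1 / 2 : ℂ) • ((1 : Matrix (Fin M) (Fin M) ℂ) -
      Complex.I • ((∑ j : Fin n, (e j : ℂ) • α j) * (∑ j : Fin n, (etil j : ℂ) • α j))))
    (hPm : Pm = (1 / 2 : ℂ) • ((1 : Matrix (Fin M) (Fin M) ℂ) +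
      Complex.I • ((∑ j : Fin n, (e j : ℂ) • α j) * (∑ j : Fin n, (etil j : ℂ) • α j)))) :
    Pp.IsHermitian ∧ Pm.IsHermitian ∧ Pp * Pp = Pp ∧ Pm * Pm = Pm ∧ Pp + Pm = 1 ∧
    Pp * D * Pp = 0 ∧ Pm * D * Pm = 0 ∧
    ∀ u : Fin M → ℂ,
      ‖(WithLp.equiv 2 (Fin M → ℂ)).symm (D.mulVec (Pp.mulVec u))‖ =
          Gp * ‖(WithLp.equiv 2 (Fin M → ℂ)).symm (Pp.mulVec u)‖ ∧
      ‖(WithLp.equiv 2 (Fin M → ℂ)).symm (D.mulVec (Pm.mulVec u))‖ =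
          Gm * ‖(WithLp.equiv 2 (Fin M → ℂ)).symm (Pm.mulVec u)‖ := by
  have hs : ‖perp e y‖ ≠ 0 := norm_ne_zero_iff.mpr hy
  obtain ⟨s, hsd⟩ : ∃ s, s = ‖perp e y‖ := ⟨_, rfl⟩
  obtain ⟨t, ht⟩ : ∃ t : ℝ, t = ⟪y, e⟫ := ⟨_, rfl⟩
  obtain ⟨A, hAd⟩ : ∃ A, A = ∑ j : Fin n, (e j : ℂ) • α j := ⟨_, rfl⟩
  obtain ⟨B, hBd⟩ : ∃ B, B = ∑ j : Fin n, (etil j : ℂ) • α j := ⟨_, rfl⟩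
  have hee : (⟪e, e⟫ : ℝ) = 1 := by rw [real_inner_self_eq_norm_sq, heu, one_pow]
  have hperp : (⟪e, perp e y⟫ : ℝ) = 0 := by
    rw [perp, inner_sub_right, inner_smul_right, hee, real_inner_comm, mul_one, sub_self]
  have heB : (⟪e, etil⟫ : ℝ) = 0 := by rw [hetil, inner_smul_right, hperp, mul_zero]
  have hBn : (⟪etil, etil⟫ : ℝ) = 1 := by
    rw [real_inner_self_eq_norm_sq, hetil, norm_smul, norm_inv, norm_norm, inv_mul_cancel₀ hs,
      one_pow]
  have hsq : ∀ C : Matrix (Fin M) (Fin M) ℂ, C + C = ((2 * 1 : ℝ) : ℂ) • 1 → C = 1 := by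
    intro C hC
    rw [← two_smul ℂ C, mul_one, Complex.ofReal_ofNat] at hC
    exact smul_right_injective _ (two_ne_zero' ℂ) hC
  have hAA : A * A = 1 := hsq _ (by rw [hAd, sum_smul_mul_add_swap α hanti, hee])
  have hBB : B * B = 1 := hsq _ (by rw [hBd, sum_smul_mul_add_swap α hanti, hBn])
  have hBA : B * A = -(A * B) := by
    rw [eq_neg_iff_add_eq_zero, add_comm, hAd, hBd, sum_smul_mul_add_swap α hanti, heB]
    simp
  have hA : A.IsHermitian := hAd ▸ isHermitian_sum_smul α hherm e
  have hB : B.IsHermitian := hBd ▸ isHermitian_sum_smul α hherm etil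
  have hy' : y = t • e + s • etil := by
    rw [hetil, hsd, smul_inv_smul₀ hs, perp, ht]
    abel
  have hD' : D = ((t : ℂ) + Complex.I * κ) • A + (s : ℂ) • B := by
    rw [hD, hAd, hBd, Finset.smul_sum, Finset.smul_sum, ← Finset.sum_add_distrib]
    refine Finset.sum_congr rfl fun j _ => ?_
    have hyj : y j = t * e j + s * etil j := by
      conv_lhs => rw [hy']
      simp
    rw [hyj]
    push_cast
    module
  rw [← hAd, ← hBd] at hPp hPm
  rw [← hsd, ← ht] at hGp hGm
  obtain ⟨p1, p2, p3, p4⟩ := projection_of_anticommute A B hA hB hAA hBB hBA t s κ D Pp hD' hPp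
  obtain ⟨m1, m2, m3, m4⟩ := projection_of_anticommute A (-B) hA hB.neg hAA
    (by rw [neg_mul_neg, hBB]) (by rw [neg_mul, mul_neg, hBA]) t (-s) κ D Pm
    (by rw [hD']; push_cast; module) (by rw [hPm, mul_neg, smul_neg, sub_neg_eq_add])
  rw [← sub_eq_add_neg, ← hGm] at m4
  rw [← hGp] at p4
  refine ⟨p1, m1, p2, m2, ?_, p3, m3, fun u => ⟨p4 u, m4 u⟩⟩
  rw [hPp, hPm]
  module

end Danilov
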